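/- Main majorization theorem: for any density matrix ρ on ℂ^{2J+1} and any K ≥ J with k = 2(K−J), the decreasingly-ordered eigenvalue sequence of Φ^k(ρ) is majorized by that of Φ^k(|ω⟩_J⟨ω|_J) for any coherent state |ω⟩_J. Equivalently, Σ_{j=0}^m λ_j(Φ^k(ρ)) ≤ Σ_{j=0}^m λ_j^{C,k} for all m, where λ_j^{C,k} = ((2J+1)/(2K+1)) (2(K−J))!(2K−j)!/((2K)!(2(K−J)−j)!) for j ≤ 2(K−J), zero otherwise. -/

import Mathlib

open scoped BigOperators ComplexOrder

noncomputable section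

/-! We realize the `n`-particle sector of the bosonic Fock space over `ℂ²` as `ℂ^{n+1}`,
with orthonormal basis `φ_j = (j!)^{-1/2}((n-j)!)^{-1/2}(a↓*)^j(a↑*)^{n-j}|0⟩`,
`j = 0,…,n`.  Creation operators act between sectors as the rectangular matrices below. -/

/-- The creation operator `a↑*` from the `n`-particle to the `(n+1)`-particle sector:
`a↑* φ_j^{(n)} = √(n+1-j) φ_j^{(n+1)}`. -/
def aUpStar (n : ℕ) : Matrix (Fin (n + 2)) (Fin (n + 1)) ℂ :=
  Matrix.of fun i j => if (i : ℕ) = (j : ℕ) then (Real.sqrt (n + 1 - (j : ℕ)) : ℂ) else 0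

/-- The creation operator `a↓*` from the `n`-particle to the `(n+1)`-particle sector:
`a↓* φ_j^{(n)} = √(j+1) φ_{j+1}^{(n+1)}`. -/
def aDnStar (n : ℕ) : Matrix (Fin (n + 2)) (Fin (n + 1)) ℂ :=
  Matrix.of fun i j => if (i : ℕ) = (j : ℕ) + 1 then (Real.sqrt ((j : ℕ) + 1) : ℂ) else 0

/-- One Kraus step `ρ ↦ Σ_{i=↑,↓} a_i* ρ a_i`, from operators on the `n`-particle sector
to operators on the `(n+1)`-particle sector. -/
def stepT (n : ℕ) (ρ : Matrix (Fin (n + 1)) (Fin (n + 1)) ℂ) :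
    Matrix (Fin (n + 2)) (Fin (n + 2)) ℂ :=
  aUpStar n * ρ * (aUpStar n).conjTranspose + aDnStar n * ρ * (aDnStar n).conjTranspose

/-- The `k`-fold Kraus sum `Σ_{i_1,…,i_k ∈ {↑,↓}} a_{i_k}*⋯a_{i_1}* ρ a_{i_1}⋯a_{i_k}`. -/
def iterT (n : ℕ) : (k : ℕ) → Matrix (Fin (n + 1)) (Fin (n + 1)) ℂ →
    Matrix (Fin (n + k + 1)) (Fin (n + k + 1)) ℂ
  | 0, ρ => ρ
  | k + 1, ρ => stepT (n + k) (iterT n k ρ)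

/-- The coherent operator quantum channel `Φ̃^k` from spin `J` (`N = 2J`) to spin
`K = J + k/2`:
`Φ̃^k(ρ) = ((2J+1)!/(2K+1)!) Σ_{i_1,…,i_k} a_{i_k}*⋯a_{i_1}* ρ a_{i_1}⋯a_{i_k}`. -/
def channel (N k : ℕ) (ρ : Matrix (Fin (N + 1)) (Fin (N + 1)) ℂ) :
    Matrix (Fin (N + k + 1)) (Fin (N + k + 1)) ℂ :=
  (((N + 1).factorial : ℝ) / ((N + k + 1).factorial : ℝ) : ℂ) • iterT N k ρ

/-- The eigenvalues `λ_j^{C,k}` of the output of a coherent state under `Φ̃^k`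
(`N = 2J`, `2K = N + k`): `λ_j = ((2J+1)/(2K+1))·k!(2J+k−j)!/((2J+k)!(k−j)!)`
for `j ≤ k`, and `0` for `j > k`. -/
def coherentEigenvalue (N k : ℕ) (j : ℕ) : ℝ :=
  if j ≤ k then
    (((N : ℝ) + 1) / ((N : ℝ) + k + 1)) *
      ((k.factorial : ℝ) * ((N + k - j).factorial : ℝ)) /
      (((N + k).factorial : ℝ) * ((k - j).factorial : ℝ))
  else 0

/-- The `i`-th largest entry of `w` (decreasing rearrangement). -/
def sortDesc {n : ℕ} (w : Fin n → ℝ) : Fin n → ℝ :=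
  fun i => (w ∘ Tuple.sort w) i.rev

/-- `Majorizes a b` : all partial sums of the decreasing rearrangement of `a` dominate
those of `b`, and the total sums agree. -/
def Majorizes {n : ℕ} (a b : Fin n → ℝ) : Prop :=
  (∀ m : ℕ, ∑ i : Fin n, (if (i : ℕ) < m then sortDesc b i else 0) ≤
    ∑ i : Fin n, (if (i : ℕ) < m then sortDesc a i else 0)) ∧
  ∑ i, a i = ∑ i, b i

/-- `CapBound A t b`: the Hermitian matrix `A` is dominated by `t • 1 + B` for some positive
semidefinite `B` of trace at most `b`. -/
def CapBound {n : Type*} [Fintype n] [DecidableEq n] (A : Matrix n n ℂ) (t b : ℝ) : Prop :=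
  ∃ B : Matrix n n ℂ, B.PosSemidef ∧ ((t : ℂ) • (1 : Matrix n n ℂ) + B - A).PosSemidef ∧
    B.trace.re ≤ b

open scoped Matrix

section CapBound

variable {n p : Type*} [Fintype n] [DecidableEq n] [Fintype p] [DecidableEq p]

lemma CapBound.zero : CapBound (0 : Matrix n n ℂ) 0 0 :=
  ⟨0, Matrix.PosSemidef.zero, by simpa using Matrix.PosSemidef.zero, by simp⟩

lemma CapBound.add {A A' : Matrix n n ℂ} {t t' b b' : ℝ} (h : CapBound A t b)
    (h' : CapBound A' t' b') : CapBound (A + A') (t + t') (b + b') := by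
  obtain ⟨B, hB, hA, hb⟩ := h
  obtain ⟨B', hB', hA', hb'⟩ := h'
  refine ⟨B + B', hB.add hB', ?_, ?_⟩
  · convert hA.add hA' using 1
    push_cast
    rw [add_smul]
    abel
  · rw [Matrix.trace_add, Complex.add_re]
    exact add_le_add hb hb'

lemma CapBound.smul {A : Matrix n n ℂ} {t b c : ℝ} (hc : 0 ≤ c) (h : CapBound A t b) :
    CapBound ((c : ℂ) • A) (c * t) (c * b) := by
  obtain ⟨B, hB, hA, hb⟩ := h
  have hc' : (0 : ℂ) ≤ (c : ℂ) := by exact_mod_cast hc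
  refine ⟨(c : ℂ) • B, hB.smul hc', ?_, ?_⟩
  · convert hA.smul hc' using 1
    push_cast
    rw [smul_sub, smul_add, smul_smul]
  · rw [Matrix.trace_smul, smul_eq_mul, Complex.re_ofReal_mul]
    exact mul_le_mul_of_nonneg_left hb hc

lemma CapBound.sum {ι : Type*} (s : Finset ι) {A : ι → Matrix n n ℂ} {t b : ι → ℝ}
    (h : ∀ i ∈ s, CapBound (A i) (t i) (b i)) :
    CapBound (∑ i ∈ s, A i) (∑ i ∈ s, t i) (∑ i ∈ s, b i) := by
  classical
  induction s using Finset.induction_on with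
  | empty => simpa using CapBound.zero
  | insert a s ha ih =>
    rw [Finset.sum_insert ha, Finset.sum_insert ha, Finset.sum_insert ha]
    exact (h a (Finset.mem_insert_self a s)).add
      (ih fun i hi => h i (Finset.mem_insert_of_mem hi))

lemma CapBound.of_eq_scalar (t : ℝ) : CapBound ((t : ℂ) • (1 : Matrix n n ℂ)) t 0 :=
  ⟨0, Matrix.PosSemidef.zero, by simpa using Matrix.PosSemidef.zero, by simp⟩

lemma CapBound.of_posSemidef {A : Matrix n n ℂ} (hA : A.PosSemidef) :
    CapBound A 0 A.trace.re :=
  ⟨A, hA, by simpa using Matrix.PosSemidef.zero, le_rfl⟩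

lemma capBound_iff_sum_eigenvalues {A : Matrix n n ℂ} (hA : A.IsHermitian) (t b : ℝ) :
    CapBound A t b ↔ ∑ i, max (hA.eigenvalues i - t) 0 ≤ b := by
  set U : Matrix n n ℂ := (hA.eigenvectorUnitary : Matrix n n ℂ) with hU
  have h1 : Uᴴ * U = 1 := Unitary.coe_star_mul_self hA.eigenvectorUnitary
  have h2 : U * Uᴴ = 1 := Unitary.coe_mul_star_self hA.eigenvectorUnitary
  have hspec : A = U * Matrix.diagonal (fun i => (hA.eigenvalues i : ℂ)) * Uᴴ :=
    hA.spectral_theorem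
  have hdiag : Uᴴ * A * U = Matrix.diagonal (fun i => (hA.eigenvalues i : ℂ)) := by
    conv_lhs => rw [hspec]
    calc Uᴴ * (U * Matrix.diagonal (fun i => (hA.eigenvalues i : ℂ)) * Uᴴ) * U
        = (Uᴴ * U) * Matrix.diagonal (fun i => (hA.eigenvalues i : ℂ)) * (Uᴴ * U) := by
          simp only [Matrix.mul_assoc]
      _ = _ := by rw [h1, Matrix.one_mul, Matrix.mul_one]
  constructor
  · rintro ⟨B, hB, hAB, hb⟩
    have hB' := hB.conjTranspose_mul_mul_same U
    have hAB' := hAB.conjTranspose_mul_mul_same U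
    have htr : (Uᴴ * B * U).trace = B.trace := by
      rw [Matrix.trace_mul_comm, ← Matrix.mul_assoc, h2, Matrix.one_mul]
    have hexp : Uᴴ * ((t : ℂ) • (1 : Matrix n n ℂ) + B - A) * U
        = (t : ℂ) • (1 : Matrix n n ℂ) + Uᴴ * B * U
          - Matrix.diagonal (fun i => (hA.eigenvalues i : ℂ)) := by
      rw [← hdiag, Matrix.mul_sub, Matrix.mul_add, Matrix.sub_mul, Matrix.add_mul]
      simp [h1]
    rw [hexp] at hAB'
    refine le_trans ?_ hb
    rw [← htr, Matrix.trace, Complex.re_sum]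
    refine Finset.sum_le_sum fun i _ => max_le ?_ ?_
    · have := (Complex.le_def.mp (hAB'.diag_nonneg (i := i))).1
      simp at this
      simp only [Matrix.diag_apply]
      linarith
    · exact (Complex.le_def.mp (hB'.diag_nonneg (i := i))).1
  · intro hb
    refine ⟨U * Matrix.diagonal (fun i => ((max (hA.eigenvalues i - t) 0 : ℝ) : ℂ)) * Uᴴ,
      ?_, ?_, ?_⟩
    · refine Matrix.PosSemidef.mul_mul_conjTranspose_same (Matrix.PosSemidef.diagonal ?_) U
      intro i
      simp only [Pi.zero_apply]
      exact_mod_cast le_max_right _ _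
    · have hexp : (t : ℂ) • (1 : Matrix n n ℂ)
          + U * Matrix.diagonal (fun i => ((max (hA.eigenvalues i - t) 0 : ℝ) : ℂ)) * Uᴴ - A
          = U * Matrix.diagonal (fun i =>
            ((t + max (hA.eigenvalues i - t) 0 - hA.eigenvalues i : ℝ) : ℂ)) * Uᴴ := by
        have hd : Matrix.diagonal (fun i =>
            ((t + max (hA.eigenvalues i - t) 0 - hA.eigenvalues i : ℝ) : ℂ))
            = (t : ℂ) • (1 : Matrix n n ℂ)
              + Matrix.diagonal (fun i => ((max (hA.eigenvalues i - t) 0 : ℝ) : ℂ))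
              - Matrix.diagonal (fun i => (hA.eigenvalues i : ℂ)) := by
          rw [Matrix.smul_one_eq_diagonal, Matrix.diagonal_add, Matrix.diagonal_sub]
          push_cast
          rfl
        rw [hd, Matrix.mul_sub, Matrix.mul_add, Matrix.sub_mul, Matrix.add_mul, ← hspec]
        simp [h2]
      rw [hexp]
      refine Matrix.PosSemidef.mul_mul_conjTranspose_same (Matrix.PosSemidef.diagonal ?_) U
      intro i
      simp only [Pi.zero_apply]
      have : 0 ≤ t + max (hA.eigenvalues i - t) 0 - hA.eigenvalues i := by
        linarith [le_max_left (hA.eigenvalues i - t) 0]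
      exact_mod_cast this
    · rw [Matrix.trace_mul_comm, ← Matrix.mul_assoc, h1, Matrix.one_mul, Matrix.trace_diagonal,
        Complex.re_sum]
      simpa only [Complex.ofReal_re] using hb

lemma sum_eigenvalues_eq_sum_roots {A : Matrix n n ℂ} (hA : A.IsHermitian) (f : ℝ → ℝ) :
    ∑ i, f (hA.eigenvalues i) = (A.charpoly.roots.map fun z => f z.re).sum := by
  rw [hA.roots_charpoly_eq_eigenvalues, Multiset.map_map]
  rfl

lemma sum_roots_charpoly_mul_comm (V : Matrix n p ℂ) (W : Matrix p n ℂ) (f : ℝ → ℝ)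
    (hf : f 0 = 0) :
    ((V * W).charpoly.roots.map fun z => f z.re).sum
      = ((W * V).charpoly.roots.map fun z => f z.re).sum := by
  have key := congrArg Polynomial.roots (Matrix.charpoly_mul_comm' V W)
  rw [Polynomial.roots_mul (mul_ne_zero (pow_ne_zero _ Polynomial.X_ne_zero)
      (Matrix.charpoly_monic _).ne_zero),
    Polynomial.roots_mul (mul_ne_zero (pow_ne_zero _ Polynomial.X_ne_zero)
      (Matrix.charpoly_monic _).ne_zero), Polynomial.roots_pow, Polynomial.roots_pow,
    Polynomial.roots_X] at key
  have := congrArg (fun s : Multiset ℂ => (s.map fun z => f z.re).sum) key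
  simpa [Multiset.map_nsmul, Multiset.sum_nsmul, hf] using this

lemma CapBound.mul_conjTranspose_of_conjTranspose_mul {V : Matrix n p ℂ} {t b : ℝ} (ht : 0 ≤ t)
    (h : CapBound (Vᴴ * V) t b) : CapBound (V * Vᴴ) t b := by
  have h1 := Matrix.isHermitian_conjTranspose_mul_self V
  have h2 := Matrix.isHermitian_mul_conjTranspose_self V
  rw [capBound_iff_sum_eigenvalues h1, sum_eigenvalues_eq_sum_roots h1 fun x => max (x - t) 0] at h
  rw [capBound_iff_sum_eigenvalues h2, sum_eigenvalues_eq_sum_roots h2 fun x => max (x - t) 0,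
    sum_roots_charpoly_mul_comm V Vᴴ (fun x => max (x - t) 0) (by simpa using ht)]
  exact h

end CapBound

section Kraus

/-- `√(j! (n - j)!)`, the norm of the monomial `(a↓*)^j (a↑*)^(n-j) |0⟩`. -/
def monomialNorm (n j : ℕ) : ℝ := √(j.factorial : ℝ) * √((n - j).factorial : ℝ)

lemma monomialNorm_pos (n j : ℕ) : 0 < monomialNorm n j := by
  unfold monomialNorm
  have h1 : (0 : ℝ) < (j.factorial : ℝ) := by exact_mod_cast Nat.factorial_pos j
  have h2 : (0 : ℝ) < ((n - j).factorial : ℝ) := by exact_mod_cast Nat.factorial_pos (n - j)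
  exact mul_pos (Real.sqrt_pos.2 h1) (Real.sqrt_pos.2 h2)

/-- The matrix of `(a↓*)^u (a↑*)^(k-u)` from the `N`-particle to the `(N+k)`-particle sector. -/
def creationMonomial (N k u : ℕ) : Matrix (Fin (N + k + 1)) (Fin (N + 1)) ℂ :=
  Matrix.of fun i a =>
    if (i : ℕ) = a + u then ((monomialNorm (N + k) i / monomialNorm N a : ℝ) : ℂ) else 0

lemma creationMonomial_zero (N : ℕ) : creationMonomial N 0 0 = 1 := by
  ext i a
  have := (monomialNorm_pos N a).ne'
  by_cases h : i = a
  · subst h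
    simp [creationMonomial, this]
  · have h' : (i : ℕ) ≠ a := fun e => h (Fin.ext e)
    rw [Matrix.one_apply_ne h]
    simp [creationMonomial, h']

lemma aUpStar_mul_creationMonomial (N k u : ℕ) (hu : u ≤ k) :
    aUpStar (N + k) * creationMonomial N k u = creationMonomial N (k + 1) u := by
  ext i a
  have ha : (a : ℕ) + u < N + k + 1 := by have := a.2; omega
  rw [Matrix.mul_apply, Finset.sum_eq_single (⟨a + u, ha⟩ : Fin (N + k + 1))]
  · simp only [aUpStar, creationMonomial, Matrix.of_apply]
    by_cases h : (i : ℕ) = a + u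
    · simp only [h, if_true]
      rw [← Complex.ofReal_mul]
      congr 1
      rw [← mul_div_assoc]
      congr 1
      unfold monomialNorm
      have e : N + (k + 1) - (a + u) = (N + k - (a + u)) + 1 := by omega
      rw [e, Nat.factorial_succ]
      have e2 : ((N + k : ℕ) : ℝ) + 1 - ((a + u : ℕ) : ℝ) = ((N + k - (a + u) + 1 : ℕ) : ℝ) := by
        have e3 : N + k - (a + u) + 1 + (a + u) = N + k + 1 := by omega
        have e4 := congrArg (Nat.cast : ℕ → ℝ) e3
        push_cast at e4 ⊢
        linarith
      rw [e2, Nat.cast_mul, Real.sqrt_mul (Nat.cast_nonneg _)]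
      ring
    · simp [h]
  · intro j _ hj
    have : (j : ℕ) ≠ a + u := fun e => hj (Fin.ext e)
    simp [creationMonomial, this]
  · simp

lemma aDnStar_mul_creationMonomial (N k u : ℕ) (hu : u ≤ k) :
    aDnStar (N + k) * creationMonomial N k u = creationMonomial N (k + 1) (u + 1) := by
  ext i a
  have ha : (a : ℕ) + u < N + k + 1 := by have := a.2; omega
  rw [Matrix.mul_apply, Finset.sum_eq_single (⟨a + u, ha⟩ : Fin (N + k + 1))]
  · simp only [aDnStar, creationMonomial, Matrix.of_apply]
    by_cases h : (i : ℕ) = a + u + 1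
    · have h' : (i : ℕ) = a + (u + 1) := by omega
      rw [if_pos h, if_pos h']
      simp only [if_true]
      rw [← Complex.ofReal_mul]
      congr 1
      rw [← mul_div_assoc]
      congr 1
      unfold monomialNorm
      have e : N + (k + 1) - i = N + k - (a + u) := by omega
      rw [e, h, Nat.factorial_succ, Nat.cast_mul, Real.sqrt_mul (Nat.cast_nonneg _)]
      push_cast
      ring
    · have h' : ¬ (i : ℕ) = a + (u + 1) := by omega
      rw [if_neg h, if_neg h', zero_mul]
  · intro j _ hj
    have : (j : ℕ) ≠ a + u := fun e => hj (Fin.ext e)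
    simp [creationMonomial, this]
  · simp

lemma sum_choose_succ_smul {M : Type*} [AddCommMonoid M] (f : ℕ → M) (k : ℕ) :
    ∑ u ∈ Finset.range (k + 2), (k + 1).choose u • f u
      = ∑ u ∈ Finset.range (k + 1), k.choose u • (f u + f (u + 1)) := by
  rw [Finset.sum_range_succ']
  simp only [Nat.choose_succ_succ, add_smul, smul_add, Finset.sum_add_distrib]
  rw [Finset.sum_range_succ (fun x => k.choose (x + 1) • f (x + 1)) k,
    Finset.sum_range_succ' (fun x => k.choose x • f x) k]
  simp only [Nat.choose_succ_self, zero_smul, add_zero, Nat.choose_zero_right]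
  abel

lemma iterT_eq_sum_creationMonomial (N k : ℕ) (ρ : Matrix (Fin (N + 1)) (Fin (N + 1)) ℂ) :
    iterT N k ρ = ∑ u ∈ Finset.range (k + 1),
      k.choose u • (creationMonomial N k u * ρ * (creationMonomial N k u)ᴴ) := by
  induction k with
  | zero =>
    simp only [zero_add, Finset.sum_range_one, Nat.choose_self, one_smul]
    rw [creationMonomial_zero]
    simp [iterT]
  | succ k ih =>
    have hstep : iterT N (k + 1) ρ = stepT (N + k) (iterT N k ρ) := rfl
    rw [hstep, ih, sum_choose_succ_smul
      (fun u => creationMonomial N (k + 1) u * ρ * (creationMonomial N (k + 1) u)ᴴ)]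
    unfold stepT
    rw [Matrix.mul_sum, Matrix.mul_sum, Matrix.sum_mul, Matrix.sum_mul, ← Finset.sum_add_distrib]
    refine Finset.sum_congr rfl fun u hu => ?_
    have hu' : u ≤ k := Nat.lt_succ_iff.mp (Finset.mem_range.mp hu)
    rw [← aUpStar_mul_creationMonomial N k u hu', ← aDnStar_mul_creationMonomial N k u hu',
      Matrix.conjTranspose_mul, Matrix.conjTranspose_mul, smul_add]
    simp only [Matrix.mul_smul, Matrix.smul_mul, Matrix.mul_assoc]

/-- The matrix element `√(k! * C(i, u) * C(i', k - u))` of the normalized Kraus operators. -/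
def krausWeight (k i i' u : ℕ) : ℝ :=
  √(k.factorial : ℝ) * (√(i.choose u : ℝ) * √(i'.choose (k - u) : ℝ))

/-- The `u`-th normalized Kraus operator `a ↦ a + u`, with target sector of `m` particles. -/
def kraus (n k m u : ℕ) : Matrix (Fin (m + 1)) (Fin (n + 1)) ℂ :=
  Matrix.of fun i a => if (i : ℕ) = a + u then (krausWeight k i (m - i) u : ℂ) else 0

lemma krausWeight_mul_monomialNorm {N k a u : ℕ} (ha : a ≤ N) (hu : u ≤ k) :
    krausWeight k (a + u) (N + k - (a + u)) u
      = √(k.choose u : ℝ) * (monomialNorm (N + k) (a + u) / monomialNorm N a) := by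
  rw [← mul_div_assoc, eq_div_iff (monomialNorm_pos N a).ne']
  unfold krausWeight monomialNorm
  simp only [← Real.sqrt_mul (Nat.cast_nonneg _), ← Nat.cast_mul]
  congr 2
  have e : N + k - (a + u) = (N - a) + (k - u) := by omega
  rw [e]
  have h1 := Nat.add_choose_mul_factorial_mul_factorial a u
  have h2 := Nat.add_choose_mul_factorial_mul_factorial (N - a) (k - u)
  have h3 := Nat.choose_mul_factorial_mul_factorial hu
  rw [← h1, ← h2, ← h3]
  have s1 : (a + u).choose u = (a + u).choose a := (Nat.choose_symm_add).symm
  have s2 : (N - a + (k - u)).choose (k - u) = (N - a + (k - u)).choose (N - a) :=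
    (Nat.choose_symm_add).symm
  rw [s1, s2]
  ring

/-- The Kraus map with Kraus operators `kraus n k m u`, `u ≤ k`. -/
def krausMap (n k m : ℕ) (ρ : Matrix (Fin (n + 1)) (Fin (n + 1)) ℂ) :
    Matrix (Fin (m + 1)) (Fin (m + 1)) ℂ :=
  ∑ u ∈ Finset.range (k + 1), kraus n k m u * ρ * (kraus n k m u)ᴴ

lemma kraus_eq_smul (N k u : ℕ) (hu : u ≤ k) :
    kraus N k (N + k) u = ((√(k.choose u : ℝ) : ℝ) : ℂ) • creationMonomial N k u := by
  ext i a
  simp only [kraus, creationMonomial, Matrix.of_apply, Matrix.smul_apply, smul_eq_mul]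
  by_cases h : (i : ℕ) = a + u
  · rw [if_pos h, if_pos h, h, krausWeight_mul_monomialNorm (Nat.lt_succ_iff.mp a.2) hu,
      Complex.ofReal_mul]
  · rw [if_neg h, if_neg h, mul_zero]

lemma iterT_eq_krausMap (N k : ℕ) (ρ : Matrix (Fin (N + 1)) (Fin (N + 1)) ℂ) :
    iterT N k ρ = krausMap N k (N + k) ρ := by
  rw [iterT_eq_sum_creationMonomial, krausMap]
  refine Finset.sum_congr rfl fun u hu => ?_
  rw [kraus_eq_smul N k u (Nat.lt_succ_iff.mp (Finset.mem_range.mp hu)),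
    Matrix.conjTranspose_smul, Matrix.smul_mul, Matrix.smul_mul, Matrix.mul_smul, smul_smul]
  have : ((√(k.choose u : ℝ) : ℝ) : ℂ) * star ((√(k.choose u : ℝ) : ℝ) : ℂ) = (k.choose u : ℂ) := by
    rw [Complex.star_def, Complex.conj_ofReal, ← Complex.ofReal_mul,
      Real.mul_self_sqrt (Nat.cast_nonneg _)]
    simp
  rw [this, Nat.cast_smul_eq_nsmul]

end Kraus

section NormalOrdering

/-- The coefficient `√(C(r, u) C(a, r - u)) √(C(s, u) C(b, s - u))` arising when the operators of
one mode are brought into normal order. -/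
def orderingCoeff (r s a b u : ℕ) : ℝ :=
  (√(r.choose u : ℝ) * √(a.choose (r - u) : ℝ)) * (√(s.choose u : ℝ) * √(b.choose (s - u) : ℝ))

lemma sqrt_mul_sqrt_of_mul_eq {x y A B : ℝ} (hx : 0 ≤ x) (hA : 0 < A) (h : y * A = x * B) :
    √y * √x = x * √(B / A) := by
  have hy : y = x * (B / A) := by
    rw [← mul_div_assoc, eq_div_iff hA.ne', h]
  rw [hy, Real.sqrt_mul hx, mul_right_comm, Real.mul_self_sqrt hx]

lemma choose_mul_choose_mul_factorial {r s a b u : ℕ} (h : a + s = b + r) (hr : u ≤ r)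
    (hs : u ≤ s) :
    r.choose u * b.choose (s - u) * (s.factorial * a.factorial)
      = s.choose u * a.choose (r - u) * (r.factorial * b.factorial) := by
  by_cases ha : r - u ≤ a
  · have hb : s - u ≤ b := by omega
    have e : b - (s - u) = a - (r - u) := by omega
    rw [← Nat.choose_mul_factorial_mul_factorial hr, ← Nat.choose_mul_factorial_mul_factorial hs,
      ← Nat.choose_mul_factorial_mul_factorial ha, ← Nat.choose_mul_factorial_mul_factorial hb, e]
    ring
  · rw [Nat.choose_eq_zero_of_lt (by omega : a < r - u),
      Nat.choose_eq_zero_of_lt (by omega : b < s - u)]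
    simp

lemma orderingCoeff_eq_zero {r s a b u : ℕ} (hu : r < u) : orderingCoeff r s a b u = 0 := by
  simp [orderingCoeff, Nat.choose_eq_zero_of_lt hu]

lemma orderingCoeff_eq {r s a b u : ℕ} (h : a + s = b + r) (hu : u ≤ r) :
    orderingCoeff r s a b u = ((s.choose u * a.choose (r - u) : ℕ) : ℝ)
      * √(((r.factorial * b.factorial : ℕ) : ℝ) / ((s.factorial * a.factorial : ℕ) : ℝ)) := by
  by_cases hs : u ≤ s
  · rw [← sqrt_mul_sqrt_of_mul_eq (y := ((r.choose u * b.choose (s - u) : ℕ) : ℝ))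
      (Nat.cast_nonneg _)]
    · rw [orderingCoeff, Nat.cast_mul, Nat.cast_mul, Real.sqrt_mul (Nat.cast_nonneg _),
        Real.sqrt_mul (Nat.cast_nonneg _)]
      ring
    · exact_mod_cast Nat.mul_pos (Nat.factorial_pos _) (Nat.factorial_pos _)
    · exact_mod_cast choose_mul_choose_mul_factorial h hu hs
  · simp [orderingCoeff, Nat.choose_eq_zero_of_lt (not_le.mp hs)]

lemma sum_choose_mul_choose (m n r : ℕ) :
    ∑ u ∈ Finset.range (r + 1), m.choose u * n.choose (r - u) = (m + n).choose r := by
  rw [Nat.add_choose_eq, Finset.Nat.sum_antidiagonal_eq_sum_range_succ_mk]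

lemma sum_orderingCoeff {r s a b M : ℕ} (h : a + s = b + r) (hM : r < M) :
    ∑ u ∈ Finset.range M, orderingCoeff r s a b u
      = √((b + r).choose r : ℝ) * √((a + s).choose s : ℝ) := by
  have h1 : ∑ u ∈ Finset.range M, orderingCoeff r s a b u
      = ∑ u ∈ Finset.range (r + 1), orderingCoeff r s a b u := by
    symm
    apply Finset.sum_subset
    · intro u hu
      rw [Finset.mem_range] at hu ⊢
      omega
    · intro u _ hu
      rw [Finset.mem_range] at hu
      exact orderingCoeff_eq_zero (by omega)
  rw [h1, Finset.sum_congr rfl fun u hu =>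
    orderingCoeff_eq h (Nat.lt_succ_iff.mp (Finset.mem_range.mp hu)), ← Finset.sum_mul,
    ← Nat.cast_sum, sum_choose_mul_choose, mul_comm √((b + r).choose r : ℝ), add_comm s a]
  rw [← sqrt_mul_sqrt_of_mul_eq (y := ((a + s).choose s : ℝ)) (Nat.cast_nonneg _)]
  · rw [h]
  · exact_mod_cast Nat.mul_pos (Nat.factorial_pos _) (Nat.factorial_pos _)
  · have h2 := Nat.add_choose_mul_factorial_mul_factorial a s
    have h3 := Nat.add_choose_mul_factorial_mul_factorial b r
    have h4 : (a + s).choose s * (s.factorial * a.factorial)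
        = (a + s).choose r * (r.factorial * b.factorial) := by
      calc (a + s).choose s * (s.factorial * a.factorial)
          = (a + s).choose s * a.factorial * s.factorial := by ring
        _ = (b + r).choose r * b.factorial * r.factorial := by rw [h2, h3, h]
        _ = _ := by rw [h]; ring
    exact_mod_cast h4

lemma krausWeight_mul_krausWeight_eq {N k q r s a b u : ℕ} (hu : u ≤ q) :
    (krausWeight q r (k - r) u * krausWeight (k - q) a (N - a) (r - u))
      * (krausWeight q s (k - s) u * krausWeight (k - q) b (N - b) (s - u))
      = (q.factorial * (k - q).factorial : ℕ)
        * (orderingCoeff r s a b u * orderingCoeff (k - r) (k - s) (N - a) (N - b) (q - u)) := by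
  by_cases h1 : r < u
  · rw [orderingCoeff_eq_zero h1]
    simp [krausWeight, Nat.choose_eq_zero_of_lt h1]
  by_cases h2 : s < u
  · simp [krausWeight, orderingCoeff, Nat.choose_eq_zero_of_lt h2]
  have e1 : k - q - (r - u) = k - r - (q - u) := by omega
  have e2 : k - q - (s - u) = k - s - (q - u) := by omega
  unfold krausWeight orderingCoeff
  rw [e1, e2]
  have f1 := Real.mul_self_sqrt (Nat.cast_nonneg (α := ℝ) q.factorial)
  have f2 := Real.mul_self_sqrt (Nat.cast_nonneg (α := ℝ) (k - q).factorial)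
  rw [Nat.cast_mul]
  calc _ = (√(q.factorial : ℝ) * √(q.factorial : ℝ))
      * (√((k - q).factorial : ℝ) * √((k - q).factorial : ℝ)) *
        (((√(r.choose u : ℝ) * √(a.choose (r - u) : ℝ))
          * (√(s.choose u : ℝ) * √(b.choose (s - u) : ℝ)))
        * ((√((k - r).choose (q - u) : ℝ) * √((N - a).choose (k - r - (q - u)) : ℝ))
          * (√((k - s).choose (q - u) : ℝ) * √((N - b).choose (k - s - (q - u)) : ℝ)))) := by ring
    _ = _ := by rw [f1, f2]

lemma krausWeight_normalOrder {N k r s a b : ℕ} (ha : a ≤ N) (hb : b ≤ N) (hr : r ≤ k)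
    (hs : s ≤ k) (h : a + s = b + r) :
    krausWeight k (b + r) (N + k - (b + r)) r * krausWeight k (a + s) (N + k - (a + s)) s
      = ∑ q ∈ Finset.range (k + 1), (k.choose q : ℝ) * ∑ u ∈ Finset.range (q + 1),
        (krausWeight q r (k - r) u * krausWeight (k - q) a (N - a) (r - u))
          * (krausWeight q s (k - s) u * krausWeight (k - q) b (N - b) (s - u)) := by
  have h' : (N - a) + (k - s) = (N - b) + (k - r) := by omega
  have hsum : ∀ q ∈ Finset.range (k + 1), (k.choose q : ℝ) * ∑ u ∈ Finset.range (q + 1),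
        (krausWeight q r (k - r) u * krausWeight (k - q) a (N - a) (r - u))
          * (krausWeight q s (k - s) u * krausWeight (k - q) b (N - b) (s - u))
      = (k.factorial : ℝ) * ∑ u ∈ Finset.range (q + 1), orderingCoeff r s a b u *
        orderingCoeff (k - r) (k - s) (N - a) (N - b) (q - u) := by
    intro q hq
    have hqk : q ≤ k := Nat.lt_succ_iff.mp (Finset.mem_range.mp hq)
    rw [Finset.sum_congr rfl fun u hu => krausWeight_mul_krausWeight_eq (N := N) (a := a) (b := b)
      (Nat.lt_succ_iff.mp (Finset.mem_range.mp hu)), ← Finset.mul_sum, ← mul_assoc,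
      ← Nat.choose_mul_factorial_mul_factorial hqk]
    push_cast
    ring
  rw [Finset.sum_congr rfl hsum, ← Finset.mul_sum, Finset.sum_range_diag_flip (k + 1) fun u w =>
    orderingCoeff r s a b u * orderingCoeff (k - r) (k - s) (N - a) (N - b) w]
  have hinner : ∀ u ∈ Finset.range (k + 1), ∑ w ∈ Finset.range (k + 1 - u),
      orderingCoeff r s a b u * orderingCoeff (k - r) (k - s) (N - a) (N - b) w
      = orderingCoeff r s a b u * (√((N - b + (k - r)).choose (k - r) : ℝ)
        * √((N - a + (k - s)).choose (k - s) : ℝ)) := by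
    intro u hu
    rw [← Finset.mul_sum]
    by_cases hur : u ≤ r
    · rw [sum_orderingCoeff h' (by omega)]
    · rw [orderingCoeff_eq_zero (by omega), zero_mul, zero_mul]
  rw [Finset.sum_congr rfl hinner, ← Finset.sum_mul, sum_orderingCoeff h (by omega)]
  have e1 : N - b + (k - r) = N + k - (b + r) := by omega
  have e2 : N - a + (k - s) = N + k - (a + s) := by omega
  rw [e1, e2]
  unfold krausWeight
  have f1 := Real.mul_self_sqrt (Nat.cast_nonneg (α := ℝ) k.factorial)
  conv_rhs => rw [← f1]
  ring

end NormalOrdering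

section Complementary

/-- The matrix whose columns are the vectors `kraus n k m r *ᵥ v`, `r ≤ k`. -/
def krausColumns (n k m : ℕ) (v : Fin (n + 1) → ℂ) : Matrix (Fin (m + 1)) (Fin (k + 1)) ℂ :=
  Matrix.of fun i r => (kraus n k m r *ᵥ v) i

/-- The matrix whose rows are the vectors obtained from `v` by `l` annihilations. -/
def annihilatedRows (N l : ℕ) (v : Fin (N + 1) → ℂ) : Matrix (Fin (l + 1)) (Fin (N + 1)) ℂ :=
  Matrix.of fun p t => ∑ a, kraus N l N p a t * v a

/-- The unnormalized `l`-particle reduced density matrix of `v`. -/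
def reducedDensity (N l : ℕ) (v : Fin (N + 1) → ℂ) : Matrix (Fin (l + 1)) (Fin (l + 1)) ℂ :=
  annihilatedRows N l v * (annihilatedRows N l v)ᴴ

lemma reducedDensity_posSemidef (N l : ℕ) (v : Fin (N + 1) → ℂ) :
    (reducedDensity N l v).PosSemidef :=
  Matrix.posSemidef_self_mul_conjTranspose _

lemma krausMap_vecMulVec (n k m : ℕ) (v : Fin (n + 1) → ℂ) :
    krausMap n k m (Matrix.vecMulVec v (star v))
      = krausColumns n k m v * (krausColumns n k m v)ᴴ := by
  ext i j
  rw [krausMap, Matrix.sum_apply, Matrix.mul_apply, Finset.sum_range]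
  refine Finset.sum_congr rfl fun r _ => ?_
  rw [Matrix.mul_vecMulVec, Matrix.vecMulVec_mul, Matrix.vecMulVec_apply,
    ← Matrix.star_mulVec]
  rfl

lemma krausColumns_gram_apply (N k : ℕ) (v : Fin (N + 1) → ℂ) (r s : Fin (k + 1)) :
    ((krausColumns N k (N + k) v)ᴴ * krausColumns N k (N + k) v) r s
      = ∑ a : Fin (N + 1), ∑ b : Fin (N + 1), v a * star (v b) *
        (if (a : ℕ) + s = b + r then
          ((krausWeight k (b + r) (N + k - (b + r)) r
            * krausWeight k (a + s) (N + k - (a + s)) s : ℝ) : ℂ) else 0) := by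
  simp only [Matrix.mul_apply, Matrix.conjTranspose_apply, krausColumns, Matrix.of_apply,
    Matrix.mulVec, dotProduct, star_sum, Finset.sum_mul_sum]
  rw [Finset.sum_comm]
  conv_lhs =>
    enter [2, b]
    rw [Finset.sum_comm]
  rw [Finset.sum_comm]
  refine Finset.sum_congr rfl fun a _ => Finset.sum_congr rfl fun b _ => ?_
  have hs : (a : ℕ) + s < N + k + 1 := by have := a.2; have := s.2; omega
  rw [Finset.sum_eq_single (⟨a + s, hs⟩ : Fin (N + k + 1))]
  · simp only [kraus, Matrix.of_apply, if_true]
    by_cases h : (a : ℕ) + s = b + r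
    · rw [if_pos h, if_pos h, h]
      simp only [star_mul', Complex.star_def, Complex.conj_ofReal, Complex.ofReal_mul]
      ring
    · rw [if_neg h, if_neg h]
      simp
  · intro i _ hi
    have : (i : ℕ) ≠ a + s := fun e => hi (Fin.ext e)
    simp [kraus, this]
  · simp

lemma kraus_mul_annihilatedRows_apply (N k q u : ℕ) (v : Fin (N + 1) → ℂ) (hq : q ≤ k)
    (hu : u ≤ q) (r : Fin (k + 1)) (t : Fin (N + 1)) :
    (kraus (k - q) q k u * annihilatedRows N (k - q) v) r t
      = ∑ a : Fin (N + 1), v a * (if (a : ℕ) + u = t + r then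
          ((krausWeight q r (k - r) u * krausWeight (k - q) a (N - a) (r - u) : ℝ) : ℂ)
          else 0) := by
  simp only [Matrix.mul_apply, annihilatedRows, Matrix.of_apply, Finset.mul_sum]
  rw [Finset.sum_comm]
  refine Finset.sum_congr rfl fun a _ => ?_
  by_cases hur : u ≤ r
  · by_cases hrl : (r : ℕ) - u ≤ k - q
    · rw [Finset.sum_eq_single (⟨r - u, by omega⟩ : Fin (k - q + 1))]
      · have h1 : (r : ℕ) = r - u + u := by omega
        simp only [kraus, Matrix.of_apply]
        rw [if_pos h1]
        by_cases h : (a : ℕ) + u = t + r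
        · have h2 : (a : ℕ) = t + (r - u) := by omega
          rw [if_pos h, if_pos h2, Complex.ofReal_mul]
          ring
        · have h2 : ¬ (a : ℕ) = t + (r - u) := by omega
          rw [if_neg h, if_neg h2]
          ring
      · intro p _ hp
        have : (r : ℕ) ≠ p + u := fun e => hp (Fin.ext (by simp only; omega))
        simp [kraus, this]
      · simp
    · have hz : krausWeight q r (k - r) u = 0 := by
        simp [krausWeight, Nat.choose_eq_zero_of_lt (show k - (r : ℕ) < q - u by omega)]
      have := r.2
      simp [kraus, hz]
  · have hz : krausWeight q r (k - r) u = 0 := by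
      simp [krausWeight, Nat.choose_eq_zero_of_lt (not_le.mp hur)]
    simp [kraus, hz]

lemma krausMap_reducedDensity_apply (N k q : ℕ) (v : Fin (N + 1) → ℂ) (hq : q ≤ k)
    (r s : Fin (k + 1)) :
    krausMap (k - q) q k (reducedDensity N (k - q) v) r s
      = ∑ a : Fin (N + 1), ∑ b : Fin (N + 1), v a * star (v b) *
        (if (a : ℕ) + s = b + r then ((∑ u ∈ Finset.range (q + 1),
          (krausWeight q r (k - r) u * krausWeight (k - q) a (N - a) (r - u))
          * (krausWeight q s (k - s) u * krausWeight (k - q) b (N - b) (s - u)) : ℝ) : ℂ)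
          else 0) := by
  have hterm : ∀ u ∈ Finset.range (q + 1),
      (kraus (k - q) q k u * reducedDensity N (k - q) v * (kraus (k - q) q k u)ᴴ) r s
      = ∑ a : Fin (N + 1), ∑ b : Fin (N + 1), v a * star (v b) *
        (if (a : ℕ) + s = b + r then
          (((krausWeight q r (k - r) u * krausWeight (k - q) a (N - a) (r - u))
          * (krausWeight q s (k - s) u * krausWeight (k - q) b (N - b) (s - u)) : ℝ) : ℂ)
          else 0) := by
    intro u hu
    have huq : u ≤ q := Nat.lt_succ_iff.mp (Finset.mem_range.mp hu)
    have hfac : kraus (k - q) q k u * reducedDensity N (k - q) v * (kraus (k - q) q k u)ᴴ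
        = (kraus (k - q) q k u * annihilatedRows N (k - q) v)
          * (kraus (k - q) q k u * annihilatedRows N (k - q) v)ᴴ := by
      rw [reducedDensity, Matrix.conjTranspose_mul]
      simp only [Matrix.mul_assoc]
    rw [hfac, Matrix.mul_apply]
    simp only [Matrix.conjTranspose_apply, kraus_mul_annihilatedRows_apply N k q u v hq huq,
      star_sum, Finset.sum_mul_sum]
    rw [Finset.sum_comm]
    refine Finset.sum_congr rfl fun a _ => ?_
    rw [Finset.sum_comm]
    refine Finset.sum_congr rfl fun b _ => ?_
    by_cases hur : u ≤ r
    · by_cases har : (r : ℕ) - u ≤ a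
      · rw [Finset.sum_eq_single (⟨a - (r - u), by have := a.2; omega⟩ : Fin (N + 1))]
        · have h1 : (a : ℕ) + u = a - (r - u) + r := by omega
          simp only [if_pos h1]
          by_cases h : (a : ℕ) + s = b + r
          · have h2 : (b : ℕ) + u = a - (r - u) + s := by omega
            rw [if_pos h, if_pos h2]
            simp only [star_mul', Complex.star_def, Complex.conj_ofReal, Complex.ofReal_mul]
            ring
          · have h2 : ¬ (b : ℕ) + u = a - (r - u) + s := by omega
            rw [if_neg h, if_neg h2]
            simp
        · intro t _ ht
          have : (a : ℕ) + u ≠ t + r := fun e => ht (Fin.ext (by simp only; omega))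
          simp [this]
        · simp
      · have hz : krausWeight (k - q) a (N - a) (r - u) = 0 := by
          simp [krausWeight, Nat.choose_eq_zero_of_lt (not_le.mp har)]
        simp [hz]
    · have hz : krausWeight q r (k - r) u = 0 := by
        simp [krausWeight, Nat.choose_eq_zero_of_lt (not_le.mp hur)]
      simp [hz]
  rw [krausMap, Matrix.sum_apply, Finset.sum_congr rfl hterm, Finset.sum_comm]
  refine Finset.sum_congr rfl fun a _ => ?_
  rw [Finset.sum_comm]
  refine Finset.sum_congr rfl fun b _ => ?_
  rw [← Finset.mul_sum]
  by_cases h : (a : ℕ) + s = b + r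
  · simp only [if_pos h]
    rw [Complex.ofReal_sum]
  · simp [h]

/-- Bringing the complementary output into normal order. -/
lemma krausColumns_gram (N k : ℕ) (v : Fin (N + 1) → ℂ) :
    (krausColumns N k (N + k) v)ᴴ * krausColumns N k (N + k) v
      = ∑ q ∈ Finset.range (k + 1), ((k.choose q : ℝ) : ℂ) •
        krausMap (k - q) q k (reducedDensity N (k - q) v) := by
  ext r s
  rw [krausColumns_gram_apply, Matrix.sum_apply]
  have hterm : ∀ q ∈ Finset.range (k + 1), (((k.choose q : ℝ) : ℂ) •
      krausMap (k - q) q k (reducedDensity N (k - q) v)) r s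
      = ∑ a : Fin (N + 1), ∑ b : Fin (N + 1), v a * star (v b) *
        (if (a : ℕ) + s = b + r then (((k.choose q : ℝ) * ∑ u ∈ Finset.range (q + 1),
          (krausWeight q r (k - r) u * krausWeight (k - q) a (N - a) (r - u))
          * (krausWeight q s (k - s) u * krausWeight (k - q) b (N - b) (s - u)) : ℝ) : ℂ)
          else 0) := by
    intro q hq
    rw [Matrix.smul_apply, krausMap_reducedDensity_apply N k q v
      (Nat.lt_succ_iff.mp (Finset.mem_range.mp hq)), smul_eq_mul, Finset.mul_sum]
    refine Finset.sum_congr rfl fun a _ => ?_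
    rw [Finset.mul_sum]
    refine Finset.sum_congr rfl fun b _ => ?_
    split_ifs
    · rw [Complex.ofReal_mul]
      ring
    · simp
  rw [Finset.sum_congr rfl hterm]
  conv_rhs => rw [Finset.sum_comm]
  refine Finset.sum_congr rfl fun a _ => ?_
  rw [Finset.sum_comm]
  refine Finset.sum_congr rfl fun b _ => ?_
  rw [← Finset.mul_sum]
  congr 1
  by_cases h : (a : ℕ) + s = b + r
  · simp only [if_pos h]
    rw [krausWeight_normalOrder (Nat.lt_succ_iff.mp a.2) (Nat.lt_succ_iff.mp b.2)
      (Nat.lt_succ_iff.mp r.2) (Nat.lt_succ_iff.mp s.2) h, Complex.ofReal_sum]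
  · simp [h]

lemma krausWeight_mul_self (k i i' u : ℕ) : krausWeight k i i' u * krausWeight k i i' u
    = ((k.factorial * (i.choose u * i'.choose (k - u)) : ℕ) : ℝ) := by
  unfold krausWeight
  rw [← Real.sqrt_mul (Nat.cast_nonneg _), ← Real.sqrt_mul (Nat.cast_nonneg _),
    Real.mul_self_sqrt (by positivity)]
  push_cast
  ring

lemma trace_reducedDensity (N l : ℕ) (v : Fin (N + 1) → ℂ) :
    (reducedDensity N l v).trace
      = ((l.factorial * N.choose l : ℕ) : ℂ) * (Matrix.vecMulVec v (star v)).trace := by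
  have hrow : ∀ p : Fin (l + 1), reducedDensity N l v p p
      = ∑ a : Fin (N + 1), v a * star (v a) *
        ((l.factorial * ((a : ℕ).choose p * (N - a).choose (l - p)) : ℕ) : ℂ) := by
    intro p
    simp only [reducedDensity, Matrix.mul_apply, Matrix.conjTranspose_apply, annihilatedRows,
      Matrix.of_apply, star_sum, Finset.sum_mul_sum]
    rw [Finset.sum_comm]
    refine Finset.sum_congr rfl fun a _ => ?_
    rw [Finset.sum_comm, Finset.sum_eq_single a]
    · by_cases hpa : (p : ℕ) ≤ a
      · rw [Finset.sum_eq_single (⟨a - p, by have := a.2; omega⟩ : Fin (N + 1))]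
        · have h1 : (a : ℕ) = a - p + p := by omega
          simp only [kraus, Matrix.of_apply, if_pos h1]
          rw [star_mul', Complex.star_def, Complex.conj_ofReal]
          have := congrArg (Complex.ofReal) (krausWeight_mul_self l a (N - a) p)
          rw [Complex.ofReal_mul, Complex.ofReal_natCast] at this
          rw [← this]
          ring
        · intro t _ ht
          have : (a : ℕ) ≠ t + p := fun e => ht (Fin.ext (by simp only; omega))
          simp [kraus, this]
        · simp
      · have hz : krausWeight l a (N - a) p = 0 := by
          simp [krausWeight, Nat.choose_eq_zero_of_lt (not_le.mp hpa)]
        simp [kraus, hz, Nat.choose_eq_zero_of_lt (not_le.mp hpa)]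
    · intro b _ hb
      refine Finset.sum_eq_zero fun t _ => ?_
      by_cases h : (a : ℕ) = t + p
      · have : ¬ (b : ℕ) = t + p := fun e => hb (Fin.ext (by omega))
        simp [kraus, this]
      · simp [kraus, h]
    · simp
  simp only [Matrix.trace, Matrix.diag_apply, hrow, Matrix.vecMulVec_apply, Pi.star_apply]
  rw [Finset.sum_comm, Finset.mul_sum]
  refine Finset.sum_congr rfl fun a _ => ?_
  rw [← Finset.mul_sum, mul_comm, ← Nat.cast_sum, ← Finset.mul_sum,
    Fin.sum_univ_eq_sum_range (fun p => (a : ℕ).choose p * (N - a).choose (l - p)) (l + 1),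
    sum_choose_mul_choose, Nat.add_sub_cancel' (Nat.lt_succ_iff.mp a.2)]

end Complementary

section Induction

/-- The unnormalized output eigenvalues of a coherent state. -/
def coherentWeight (N k j : ℕ) : ℝ :=
  if j ≤ k then (k.factorial : ℝ) * ((N + k - j).choose N : ℝ) else 0

lemma coherentWeight_nonneg (N k j : ℕ) : 0 ≤ coherentWeight N k j := by
  unfold coherentWeight
  split_ifs <;> positivity

lemma coherentWeight_antitone (N k : ℕ) : Antitone (coherentWeight N k) := by
  intro i j hij
  by_cases hj : j ≤ k
  · rw [coherentWeight, coherentWeight, if_pos hj, if_pos (hij.trans hj)]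
    have : (N + k - j).choose N ≤ (N + k - i).choose N := Nat.choose_le_choose N (by omega)
    have h' : ((N + k - j).choose N : ℝ) ≤ ((N + k - i).choose N : ℝ) := by exact_mod_cast this
    exact mul_le_mul_of_nonneg_left h' (Nat.cast_nonneg _)
  · have : coherentWeight N k j = 0 := if_neg hj
    rw [this]
    exact coherentWeight_nonneg N k i

lemma choose_mul_coherentWeight {N k q : ℕ} (m : ℕ) (hq : q ≤ k) :
    (k.choose q : ℝ) * (((k - q).factorial * N.choose (k - q) : ℕ) : ℝ)
        * coherentWeight (k - q) q m
      = if m ≤ k then ((k.factorial * (N.choose (k - q) * (k - m).choose (k - q)) : ℕ) : ℝ)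
        else 0 := by
  unfold coherentWeight
  by_cases hm : m ≤ q
  · rw [if_pos hm, if_pos (hm.trans hq), show k - q + q - m = k - m by omega,
      ← Nat.choose_mul_factorial_mul_factorial hq]
    push_cast
    ring
  · rw [if_neg hm, mul_zero]
    split_ifs with hmk
    · rw [Nat.choose_eq_zero_of_lt (show k - m < k - q by omega)]
      simp
    · rfl

lemma sum_choose_mul_coherentWeight (N k m : ℕ) :
    ∑ q ∈ Finset.range (k + 1), (k.choose q : ℝ) *
        (((k - q).factorial * N.choose (k - q) : ℕ) : ℝ) * coherentWeight (k - q) q m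
      = coherentWeight N k m := by
  rw [Finset.sum_congr rfl fun q hq =>
    choose_mul_coherentWeight (N := N) m (Nat.lt_succ_iff.mp (Finset.mem_range.mp hq))]
  by_cases hm : m ≤ k
  · simp only [if_pos hm]
    rw [coherentWeight, if_pos hm, ← Nat.cast_sum, ← Finset.mul_sum]
    have h1 : ∑ q ∈ Finset.range (k + 1), N.choose (k - q) * (k - m).choose (k - q)
        = (N + k - m).choose N := by
      have hrefl := Finset.sum_range_reflect (fun l => N.choose l * (k - m).choose l) (k + 1)
      simp only [Nat.add_sub_cancel] at hrefl
      rw [hrefl, show N + k - m = N + (k - m) by omega, Nat.choose_symm_add,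
        ← sum_choose_mul_choose]
      symm
      rw [Finset.sum_congr rfl fun l hl => by
        rw [Nat.choose_symm (Nat.lt_succ_iff.mp (Finset.mem_range.mp hl))]]
      apply Finset.sum_subset
      · intro l hl
        rw [Finset.mem_range] at hl ⊢
        omega
      · intro l _ hl
        rw [Finset.mem_range] at hl
        rw [Nat.choose_eq_zero_of_lt (show k - m < l by omega), mul_zero]
    rw [h1, Nat.cast_mul]
  · simp [coherentWeight, hm]

/-- The excess of the coherent weights over the `m`-th one. -/
def coherentExcess (N k m : ℕ) : ℝ :=
  ∑ j ∈ Finset.range m, (coherentWeight N k j - coherentWeight N k m)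

lemma sum_choose_mul_coherentExcess (N k m : ℕ) :
    ∑ q ∈ Finset.range (k + 1), (k.choose q : ℝ) *
        (((k - q).factorial * N.choose (k - q) : ℕ) : ℝ) * coherentExcess (k - q) q m
      = coherentExcess N k m := by
  simp only [coherentExcess, Finset.mul_sum]
  rw [Finset.sum_comm]
  refine Finset.sum_congr rfl fun j _ => ?_
  simp only [mul_sub]
  rw [Finset.sum_sub_distrib, sum_choose_mul_coherentWeight, sum_choose_mul_coherentWeight]

lemma krausMap_zero_apply (k : ℕ) (ρ : Matrix (Fin (0 + 1)) (Fin (0 + 1)) ℂ) :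
    krausMap 0 k k ρ = ((k.factorial : ℂ) * ρ.trace) • (1 : Matrix (Fin (k + 1)) (Fin (k + 1)) ℂ) := by
  ext i j
  rw [krausMap, Matrix.sum_apply, Finset.sum_range, Finset.sum_eq_single i]
  · simp only [Matrix.mul_apply, Matrix.conjTranspose_apply, kraus, Matrix.of_apply]
    by_cases h : i = j
    · subst h
      have hw := congrArg Complex.ofReal (krausWeight_mul_self k i (k - i) i)
      rw [Complex.ofReal_mul, Complex.ofReal_natCast] at hw
      simp only [Nat.choose_self, mul_one] at hw
      simp [Matrix.trace, ← hw]
      ring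
    · have h' : (j : ℕ) ≠ i := fun e => h (Fin.ext e.symm)
      simp [h, h']
  · intro u _ hu
    have : (i : ℕ) ≠ u := fun e => hu (Fin.ext e.symm)
    simp [Matrix.mul_apply, kraus, this]
  · simp

lemma capBound_krausMap_zero {n k M : ℕ} (hn : n = 0) (hM : M = n + k)
    {ρ : Matrix (Fin (n + 1)) (Fin (n + 1)) ℂ} (hρ : ρ.PosSemidef) (m : ℕ) :
    CapBound (krausMap n k M ρ) (ρ.trace.re * coherentWeight n k m)
      (ρ.trace.re * coherentExcess n k m) := by
  subst hn
  obtain rfl : M = k := by omega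
  have htr : ρ.trace = (ρ.trace.re : ℂ) :=
    Complex.ext rfl (by simpa using (Complex.le_def.mp hρ.trace_nonneg).2.symm)
  have hpos : 0 ≤ ρ.trace.re := (Complex.le_def.mp hρ.trace_nonneg).1
  have hmap : krausMap 0 M M ρ = ((M.factorial * ρ.trace.re : ℝ) : ℂ) • 1 := by
    rw [krausMap_zero_apply, htr]
    push_cast
    simp
  rw [hmap]
  have hw : ∀ j, j ≤ M → coherentWeight 0 M j = M.factorial := by
    intro j hj
    simp [coherentWeight, hj]
  by_cases hm : m ≤ M
  · have hex : coherentExcess 0 M m = 0 := by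
      refine Finset.sum_eq_zero fun j hj => ?_
      rw [hw m hm, hw j ((Finset.mem_range.mp hj).le.trans hm), sub_self]
    rw [hex, hw m hm, mul_zero, mul_comm ρ.trace.re]
    exact CapBound.of_eq_scalar _
  · have hwm : coherentWeight 0 M m = 0 := if_neg hm
    have hex : coherentExcess 0 M m = (M + 1) * M.factorial := by
      unfold coherentExcess
      rw [hwm]
      simp only [sub_zero]
      have : ∑ j ∈ Finset.range m, coherentWeight 0 M j
          = ∑ j ∈ Finset.range (M + 1), coherentWeight 0 M j := by
        symm
        apply Finset.sum_subset
        · intro j hj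
          rw [Finset.mem_range] at hj ⊢
          omega
        · intro j _ hj
          rw [Finset.mem_range] at hj
          exact if_neg (by omega)
      rw [this, Finset.sum_congr rfl fun j hj =>
        hw j (Nat.lt_succ_iff.mp (Finset.mem_range.mp hj))]
      simp
    rw [hwm, hex, mul_zero]
    have hps : (((M.factorial * ρ.trace.re : ℝ) : ℂ) •
        (1 : Matrix (Fin (M + 1)) (Fin (M + 1)) ℂ)).PosSemidef := by
      refine Matrix.PosSemidef.one.smul ?_
      have : (0 : ℝ) ≤ M.factorial * ρ.trace.re := by positivity
      exact_mod_cast this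
    have h := CapBound.of_posSemidef hps
    convert h using 1
    rw [Matrix.trace_smul, Matrix.trace_one, smul_eq_mul, Complex.re_ofReal_mul]
    simp
    ring

lemma krausMap_sum {ι : Type*} (s : Finset ι) (n k m : ℕ)
    (f : ι → Matrix (Fin (n + 1)) (Fin (n + 1)) ℂ) :
    krausMap n k m (∑ i ∈ s, f i) = ∑ i ∈ s, krausMap n k m (f i) := by
  simp only [krausMap, Matrix.mul_sum, Matrix.sum_mul]
  rw [Finset.sum_comm]

lemma capBound_krausMap (k : ℕ) : ∀ {N M : ℕ} (_ : M = N + k)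
    {ρ : Matrix (Fin (N + 1)) (Fin (N + 1)) ℂ} (_ : ρ.PosSemidef) (m : ℕ),
    CapBound (krausMap N k M ρ) (ρ.trace.re * coherentWeight N k m)
      (ρ.trace.re * coherentExcess N k m) := by
  induction k using Nat.strong_induction_on with
  | _ k ih =>
    intro N M hM ρ hρ m
    subst hM
    obtain ⟨d, v, rfl⟩ := Matrix.posSemidef_iff_eq_sum_vecMulVec.mp hρ
    rw [krausMap_sum, Matrix.trace_sum, Complex.re_sum, Finset.sum_mul, Finset.sum_mul]
    refine CapBound.sum _ fun i _ => ?_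
    have hpure := Matrix.posSemidef_vecMulVec_self_star (v i)
    have hpos : 0 ≤ (Matrix.vecMulVec (v i) (star (v i))).trace.re :=
      (Complex.le_def.mp hpure.trace_nonneg).1
    rw [krausMap_vecMulVec]
    refine CapBound.mul_conjTranspose_of_conjTranspose_mul
      (mul_nonneg hpos (coherentWeight_nonneg N k m)) ?_
    rw [krausColumns_gram, ← sum_choose_mul_coherentWeight N k m,
      ← sum_choose_mul_coherentExcess N k m, Finset.mul_sum, Finset.mul_sum]
    refine CapBound.sum _ fun q hq => ?_
    have hqk : q ≤ k := Nat.lt_succ_iff.mp (Finset.mem_range.mp hq)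
    have hred := reducedDensity_posSemidef N (k - q) (v i)
    have hbound : CapBound (krausMap (k - q) q k (reducedDensity N (k - q) (v i)))
        ((reducedDensity N (k - q) (v i)).trace.re * coherentWeight (k - q) q m)
        ((reducedDensity N (k - q) (v i)).trace.re * coherentExcess (k - q) q m) := by
      rcases hqk.lt_or_eq with hlt | heq
      · exact ih q hlt (by omega) hred m
      · exact capBound_krausMap_zero (by omega) (by omega) hred m
    have htr : (reducedDensity N (k - q) (v i)).trace.re
        = (((k - q).factorial * N.choose (k - q) : ℕ) : ℝ)
          * (Matrix.vecMulVec (v i) (star (v i))).trace.re := by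
      rw [trace_reducedDensity, ← Complex.ofReal_natCast, Complex.re_ofReal_mul]
    convert hbound.smul (Nat.cast_nonneg (k.choose q)) using 1 <;>
    · rw [htr]
      ring

end Induction

section Conclusion

lemma aUpStar_gram_add_aDnStar_gram (n : ℕ) :
    (aUpStar n)ᴴ * aUpStar n + (aDnStar n)ᴴ * aDnStar n
      = ((n + 2 : ℕ) : ℂ) • (1 : Matrix (Fin (n + 1)) (Fin (n + 1)) ℂ) := by
  ext i j
  have hi : (i : ℕ) < n + 2 := by have := i.2; omega
  have hi' : (i : ℕ) + 1 < n + 2 := by have := i.2; omega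
  rw [Matrix.add_apply, Matrix.mul_apply, Matrix.mul_apply,
    Finset.sum_eq_single (⟨i, hi⟩ : Fin (n + 2)),
    Finset.sum_eq_single (⟨i + 1, hi'⟩ : Fin (n + 2))]
  · simp only [Matrix.conjTranspose_apply, aUpStar, aDnStar, Matrix.of_apply, if_true,
      Complex.star_def, Complex.conj_ofReal]
    by_cases h : i = j
    · subst h
      have h1 : (0 : ℝ) ≤ (n : ℝ) + 1 - (i : ℕ) := by
        have : ((i : ℕ) : ℝ) ≤ n := by exact_mod_cast Nat.lt_succ_iff.mp i.2
        linarith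
      have h2 : (0 : ℝ) ≤ ((i : ℕ) : ℝ) + 1 := by positivity
      simp only [if_true, ← Complex.ofReal_mul]
      rw [Real.mul_self_sqrt h1, Real.mul_self_sqrt h2]
      simp
      ring
    · have h' : (i : ℕ) ≠ j := fun e => h (Fin.ext e)
      simp [h, h']
  · intro t _ ht
    have : (t : ℕ) ≠ i + 1 := fun e => ht (Fin.ext e)
    simp [aDnStar, this]
  · simp
  · intro t _ ht
    have : (t : ℕ) ≠ i := fun e => ht (Fin.ext e)
    simp [aUpStar, this]
  · simp

lemma trace_stepT (n : ℕ) (ρ : Matrix (Fin (n + 1)) (Fin (n + 1)) ℂ) :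
    (stepT n ρ).trace = ((n + 2 : ℕ) : ℂ) * ρ.trace := by
  rw [stepT, Matrix.trace_add, Matrix.trace_mul_comm (aUpStar n * ρ),
    Matrix.trace_mul_comm (aDnStar n * ρ), ← Matrix.mul_assoc, ← Matrix.mul_assoc,
    ← Matrix.trace_add, ← Matrix.add_mul, aUpStar_gram_add_aDnStar_gram]
  simp

lemma trace_iterT (N k : ℕ) (ρ : Matrix (Fin (N + 1)) (Fin (N + 1)) ℂ) :
    ((N + 1).factorial : ℂ) * (iterT N k ρ).trace = ((N + k + 1).factorial : ℂ) * ρ.trace := by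
  induction k with
  | zero => rfl
  | succ k ih =>
    have hstep : iterT N (k + 1) ρ = stepT (N + k) (iterT N k ρ) := rfl
    rw [hstep, trace_stepT, mul_left_comm, ih,
      show N + (k + 1) + 1 = N + k + 1 + 1 by ring, Nat.factorial_succ (N + k + 1)]
    push_cast
    ring

lemma trace_channel (N k : ℕ) (ρ : Matrix (Fin (N + 1)) (Fin (N + 1)) ℂ) :
    (channel N k ρ).trace = ρ.trace := by
  have h := trace_iterT N k ρ
  have hne : ((N + k + 1).factorial : ℂ) ≠ 0 := by exact_mod_cast Nat.factorial_ne_zero _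
  rw [channel, Matrix.trace_smul, smul_eq_mul]
  push_cast
  rw [div_mul_eq_mul_div, h, mul_div_assoc, mul_comm, div_mul_cancel₀ _ hne]

lemma coherentEigenvalue_eq (N k j : ℕ) :
    coherentEigenvalue N k j
      = ((N + 1).factorial : ℝ) / ((N + k + 1).factorial : ℝ) * coherentWeight N k j := by
  unfold coherentEigenvalue coherentWeight
  split_ifs with hj
  · have h1 := Nat.choose_mul_factorial_mul_factorial (show N ≤ N + k - j by omega)
    rw [show N + k - j - N = k - j by omega] at h1
    rw [← h1, Nat.factorial_succ, Nat.factorial_succ]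
    have e1 : ((N + k).factorial : ℝ) ≠ 0 := by exact_mod_cast Nat.factorial_ne_zero _
    have e2 : ((k - j).factorial : ℝ) ≠ 0 := by exact_mod_cast Nat.factorial_ne_zero _
    have e3 : (N : ℝ) + k + 1 ≠ 0 := by positivity
    push_cast
    field_simp
  · simp

lemma sum_coherentWeight (N k : ℕ) :
    ∑ j ∈ Finset.range (N + k + 1), coherentWeight N k j
      = ((N + k + 1).factorial : ℝ) / ((N + 1).factorial : ℝ) := by
  have h1 : ∑ j ∈ Finset.range (N + k + 1), coherentWeight N k j
      = ∑ j ∈ Finset.range (k + 1), coherentWeight N k j := by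
    symm
    apply Finset.sum_subset
    · intro j hj
      rw [Finset.mem_range] at hj ⊢
      omega
    · intro j _ hj
      rw [Finset.mem_range] at hj
      exact if_neg (by omega)
  have h2 : ∀ j ∈ Finset.range (k + 1), coherentWeight N k j
      = ((k.factorial * (k - j + N).choose N : ℕ) : ℝ) := by
    intro j hj
    have hj' : j ≤ k := Nat.lt_succ_iff.mp (Finset.mem_range.mp hj)
    rw [coherentWeight, if_pos hj', show N + k - j = k - j + N by omega, Nat.cast_mul]
  have h3 : ∑ j ∈ Finset.range (k + 1), (k - j + N).choose N = (k + N + 1).choose (N + 1) := by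
    rw [← Nat.sum_range_add_choose, ← Finset.sum_range_reflect (fun i => (i + N).choose N)]
    simp
  rw [h1, Finset.sum_congr rfl h2, ← Nat.cast_sum, ← Finset.mul_sum, h3, eq_div_iff
    (by exact_mod_cast Nat.factorial_ne_zero _), ← Nat.cast_mul]
  have h4 := Nat.choose_mul_factorial_mul_factorial (show N + 1 ≤ k + N + 1 by omega)
  rw [show k + N + 1 - (N + 1) = k by omega] at h4
  rw [show N + k + 1 = k + N + 1 by ring, ← h4]
  congr 1
  ring

lemma sum_max_sortDesc {n : ℕ} (b : Fin n → ℝ) (t : ℝ) :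
    ∑ i, max (sortDesc b i - t) 0 = ∑ i, max (b i - t) 0 :=
  Equiv.sum_comp (Fin.revPerm.trans (Tuple.sort b)) fun i => max (b i - t) 0

lemma sortDesc_of_antitone {n : ℕ} {a : Fin n → ℝ} (ha : Antitone a) : sortDesc a = a := by
  have hmono : Monotone (a ∘ Fin.revPerm) := fun i j hij => ha (Fin.rev_le_rev.mpr hij)
  have h := Tuple.comp_sort_eq_comp_iff_monotone.mpr hmono
  funext i
  have hi := congrFun h i.rev
  simp only [Function.comp_apply, Fin.revPerm_apply, Fin.rev_rev] at hi
  exact hi.symm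

lemma sum_ite_lt_eq_sum_range {n : ℕ} {a : ℕ → ℝ} (h0 : ∀ j, n ≤ j → a j = 0) (m : ℕ) :
    ∑ i : Fin n, (if (i : ℕ) < m then a i else 0) = ∑ j ∈ Finset.range m, a j := by
  rw [Fin.sum_univ_eq_sum_range (fun j => if j < m then a j else 0) n, ← Finset.sum_filter]
  apply Finset.sum_subset
  · intro j hj
    rw [Finset.mem_filter] at hj
    exact Finset.mem_range.mpr hj.2
  · intro j hj hj'
    apply h0
    by_contra hlt
    exact hj' (Finset.mem_filter.mpr ⟨Finset.mem_range.mpr (not_le.mp hlt), Finset.mem_range.mp hj⟩)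

lemma sum_ite_lt_le {n : ℕ} (w : Fin n → ℝ) (m : ℕ) {t : ℝ} (ht : 0 ≤ t) :
    ∑ i : Fin n, (if (i : ℕ) < m then w i else 0) ≤ m * t + ∑ i, max (w i - t) 0 := by
  have h1 : ∀ i : Fin n, (if (i : ℕ) < m then w i else 0)
      ≤ (if (i : ℕ) < m then t else 0) + max (w i - t) 0 := by
    intro i
    split_ifs
    · linarith [le_max_left (w i - t) 0]
    · linarith [le_max_right (w i - t) 0]
  refine (Finset.sum_le_sum fun i _ => h1 i).trans ?_
  rw [Finset.sum_add_distrib]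
  gcongr
  rw [Fin.sum_univ_eq_sum_range (fun j => if j < m then t else 0) n, ← Finset.sum_filter,
    Finset.sum_const, nsmul_eq_mul]
  gcongr
  calc _ ≤ (Finset.range m).card := Finset.card_le_card fun j hj =>
        Finset.mem_range.mpr (Finset.mem_filter.mp hj).2
    _ = m := Finset.card_range m

lemma majorizes_of_sum_max_le {n : ℕ} {a : ℕ → ℝ} {b : Fin n → ℝ} (ha : Antitone a)
    (ha0 : ∀ j, 0 ≤ a j) (han : ∀ j, n ≤ j → a j = 0)
    (hab : ∀ m, ∑ i, max (b i - a m) 0 ≤ ∑ j ∈ Finset.range m, (a j - a m))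
    (hsum : ∑ i : Fin n, a i = ∑ i, b i) : Majorizes (fun i : Fin n => a i) b := by
  refine ⟨fun m => ?_, hsum⟩
  rw [sortDesc_of_antitone fun i j hij => ha hij, sum_ite_lt_eq_sum_range han]
  refine (sum_ite_lt_le _ m (ha0 m)).trans ?_
  rw [sum_max_sortDesc]
  have := hab m
  rw [Finset.sum_sub_distrib, Finset.sum_const, Finset.card_range, nsmul_eq_mul] at this
  linarith

end Conclusion

/-- main majorization theorem: for every density matrix `ρ` on
`ℂ^{2J+1}` (`N = 2J`, `K = J + k/2`), the eigenvalue sequence of `Φ^k(ρ)` is majorized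
by the eigenvalue sequence `λ^{C,k}` of the output `Φ^k(|ω⟩⟨ω|)` of a coherent state,
where `λ_j^{C,k} = ((2J+1)/(2K+1))·(2(K−J))!(2K−j)!/((2K)!(2(K−J)−j)!)` for
`j ≤ 2(K−J) = k`, and `0` otherwise. -/
theorem channel_majorization (N k : ℕ) (ρ : Matrix (Fin (N + 1)) (Fin (N + 1)) ℂ)
    (hρ : ρ.PosSemidef) (htr : ρ.trace = 1)
    (hH : (channel N k ρ).IsHermitian) :
    Majorizes (fun j : Fin (N + k + 1) => coherentEigenvalue N k j) hH.eigenvalues := by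
  set c : ℝ := ((N + 1).factorial : ℝ) / ((N + k + 1).factorial : ℝ) with hc
  have hc0 : 0 ≤ c := by positivity
  have htr' : ρ.trace.re = 1 := by rw [htr, Complex.one_re]
  refine majorizes_of_sum_max_le (a := coherentEigenvalue N k) ?_ ?_ ?_ ?_ ?_
  · intro i j hij
    rw [coherentEigenvalue_eq, coherentEigenvalue_eq]
    exact mul_le_mul_of_nonneg_left (coherentWeight_antitone N k hij) hc0
  · intro j
    rw [coherentEigenvalue_eq]
    exact mul_nonneg hc0 (coherentWeight_nonneg N k j)
  · intro j hj
    exact if_neg (by omega)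
  · intro m
    rw [← capBound_iff_sum_eigenvalues hH]
    have h := (capBound_krausMap k rfl hρ m).smul hc0
    rw [htr', one_mul, one_mul, ← iterT_eq_krausMap] at h
    convert h using 1
    · rw [channel, hc, Complex.ofReal_div]
    · exact coherentEigenvalue_eq N k m
    · simp only [coherentExcess, Finset.mul_sum, coherentEigenvalue_eq, mul_sub, hc]
  · have h1 := congrArg Complex.re (hH.trace_eq_sum_eigenvalues)
    rw [trace_channel, htr', Complex.re_sum] at h1
    rw [Fin.sum_univ_eq_sum_range (coherentEigenvalue N k) (N + k + 1)]
    simp only [coherentEigenvalue_eq, ← Finset.mul_sum]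
    rw [sum_coherentWeight, div_mul_div_cancel₀ (by positivity), div_self (by positivity)]
    exact h1
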